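/- arXiv:math/0205305 — 5 statements merged into one kernel-verified Lean document; each statement's English description precedes it below -/
import Mathlib

section
/- Let α ∈ (0,1) and let Λ be a compact subset of the open square (0,1)² ⊂ ℝ² whose Hausdorff dimension is strictly less than 1+α. Let u : ℝ² → ℝ be a function whose support is a compact subset of (0,1)², which is Hölder continuous with exponent α (i.e. there is C > 0 with |u(x)−u(y)| ≤ C‖x−y‖^α for all x,y), which is continuously differentiable at every point of ℝ² \ Λ, and whose gradient satisfies ∫_{(0,1)²\Λ} ‖∇u‖² dx < ∞. Then for every continuously differentiable vector field v : ℝ² → ℝ², one has ∫_{(0,1)²} u(x)·(div v)(x) dx = −∫_{(0,1)²\Λ} ⟨∇u(x), v(x)⟩ dx, where div v(x) denotes the trace of the derivative of v at x. (In other words, u lies in the Sobolev space H¹ and its weak gradient is its pointwise gradient off Λ.) -/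
open MeasureTheory
open scoped RealInnerProductSpace ENNReal

/-- The open unit square `(0,1)² ⊆ ℝ²`. -/
def unitSquare : Set (EuclideanSpace ℝ (Fin 2)) := {x | ∀ i, x i ∈ Set.Ioo (0:ℝ) 1}

section Slicing

open Set Filter Topology Metric

/-- Eilenberg-type slicing: almost every fibre of a nonexpanding function on an
`ℋ^(1+β)`-null set is `ℋ^β`-null. -/
theorem ae_hausdorffMeasure_inter_preimage_eq_zero {X : Type*} [MetricSpace X]
    [MeasurableSpace X] [BorelSpace X] {p : X → ℝ} (hp : LipschitzWith 1 p) {β : ℝ} (hβ : 0 < β)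
    {s : Set X} (hs : μH[1 + β] s = 0) :
    ∀ᵐ y : ℝ, μH[β] (s ∩ p ⁻¹' {y}) = 0 := by
  have hr : ∀ n : ℕ, (0 : ℝ≥0∞) < 2⁻¹ ^ n := fun n => by
    apply ENNReal.pow_pos; simp
  have hcover : ∀ n : ℕ, ∃ t : ℕ → Set X, s ⊆ ⋃ i, t i ∧ (∀ i, ediam (t i) ≤ 2⁻¹ ^ n) ∧
      ∑' i, ediam (t i) ^ (1 + β) ≤ 2⁻¹ ^ n := by
    intro n
    rw [Measure.hausdorffMeasure_apply] at hs
    have h1 := (le_iSup₂ (f := fun (r : ℝ≥0∞) (_ : 0 < r) =>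
        ⨅ (t : ℕ → Set X) (_ : s ⊆ ⋃ n, t n) (_ : ∀ n, ediam (t n) ≤ r),
          ∑' n, ⨆ _ : (t n).Nonempty, ediam (t n) ^ (1 + β)) _ (hr n)).trans hs.le
    have h2 := h1.trans_lt (hr n)
    simp only [iInf_lt_iff] at h2
    obtain ⟨t, ht, hd, hlt⟩ := h2
    refine ⟨t, ht, hd, le_trans (ENNReal.tsum_le_tsum fun i => ?_) hlt.le⟩
    rcases (t i).eq_empty_or_nonempty with h | h
    · simp [h, show 0 < 1 + β by linarith]
    · simp [h]
  choose t hst hd hsum using hcover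
  set h : ℕ → ℝ → ℝ≥0∞ := fun n y =>
    ∑' i, (closure (p '' t n i)).indicator (fun _ => ediam (t n i) ^ β) y with hh
  have hmeas : ∀ n, Measurable (h n) := fun n =>
    Measurable.tsum fun i => measurable_const.indicator isClosed_closure.measurableSet
  have hint : ∀ n, ∫⁻ y, h n y ≤ 2⁻¹ ^ n := by
    intro n
    refine le_trans ?_ (hsum n)
    rw [lintegral_tsum fun i =>
      (measurable_const.indicator isClosed_closure.measurableSet).aemeasurable]
    refine ENNReal.tsum_le_tsum fun i => ?_
    rw [lintegral_indicator_const isClosed_closure.measurableSet,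
      ENNReal.rpow_add_of_nonneg _ _ zero_le_one hβ.le, ENNReal.rpow_one, mul_comm]
    gcongr
    calc volume (closure (p '' t n i)) ≤ ediam (closure (p '' t n i)) := Real.volume_le_diam _
      _ = ediam (p '' t n i) := ediam_closure _
      _ ≤ ediam (t n i) := by simpa using hp.ediam_image_le (t n i)
  have htot : ∫⁻ y, ∑' n, h n y ≠ ⊤ := by
    rw [lintegral_tsum fun n => (hmeas n).aemeasurable]
    refine ne_top_of_le_ne_top ?_ (ENNReal.tsum_le_tsum hint)
    rw [ENNReal.tsum_geometric]
    simp
  filter_upwards [ae_lt_top (Measurable.tsum hmeas) htot] with y hy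
  have hlim : Tendsto (fun n => h n y) atTop (𝓝 0) := by
    have := ENNReal.tendsto_cofinite_zero_of_tsum_ne_top hy.ne
    rwa [Nat.cofinite_eq_atTop] at this
  have h0 : Tendsto (fun n : ℕ => (2⁻¹ : ℝ≥0∞) ^ n) atTop (𝓝 0) :=
    ENNReal.tendsto_pow_atTop_nhds_zero_of_lt_one (by simp)
  have key := Measure.hausdorffMeasure_le_liminf_tsum β (s ∩ p ⁻¹' {y}) _ h0
    (fun n i => t n i ∩ p ⁻¹' {y})
    (Eventually.of_forall fun n i => (ediam_mono inter_subset_left).trans (hd n i))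
    (Eventually.of_forall fun n => by
      rw [← iUnion_inter]; exact inter_subset_inter_left _ (hst n))
  refine le_antisymm (key.trans ?_) zero_le
  rw [← hlim.liminf_eq]
  refine liminf_le_liminf (Eventually.of_forall fun n => ENNReal.tsum_le_tsum fun i => ?_)
  by_cases hne : (t n i ∩ p ⁻¹' {y}).Nonempty
  · obtain ⟨x, hx, hxy⟩ := hne
    rw [indicator_of_mem (subset_closure (show y ∈ p '' t n i from ⟨x, hx, hxy⟩))]
    gcongr
    exact inter_subset_left
  · rw [not_nonempty_iff_eq_empty.mp hne]
    simp [hβ]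

/-- If `f` sends the closed exceptional set `K` to a null set, the increment of `f` over an interval
is at most the integral of its derivative off `K`. -/
theorem edist_image_le_lintegral_deriv {f f' : ℝ → ℝ} {K : Set ℝ} (hf : Continuous f)
    (hK : IsClosed K) (hfK : volume (f '' K) = 0) (hf' : ∀ x ∉ K, HasDerivAt f (f' x) x)
    (a b : ℝ) : edist (f a) (f b) ≤ ∫⁻ x in uIoc a b, ‖f' x‖ₑ := by
  calc edist (f a) (f b) = volume (uIcc (f a) (f b)) := by
        rw [uIcc, Real.volume_Icc, max_sub_min_eq_abs, abs_sub_comm, edist_dist, Real.dist_eq]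
    _ ≤ volume (f '' K ∪ f '' (uIcc a b \ K)) := by
        refine measure_mono ((intermediate_value_uIcc hf.continuousOn).trans ?_)
        rw [← image_union]
        exact image_mono fun x hx => by by_cases h : x ∈ K <;> simp [h, hx]
    _ ≤ 0 + ∫⁻ x in uIcc a b \ K,
        ENNReal.ofReal |(ContinuousLinearMap.toSpanSingleton ℝ (f' x)).det| := by
        refine (measure_union_le _ _).trans (add_le_add hfK.le ?_)
        exact addHaar_image_le_lintegral_abs_det_fderiv _ (measurableSet_uIcc.diff hK.measurableSet)
          fun x hx => (hf' x hx.2).hasFDerivAt.hasFDerivWithinAt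
    _ ≤ ∫⁻ x in uIcc a b, ‖f' x‖ₑ := by
        rw [zero_add]
        simp only [ContinuousLinearMap.det_toSpanSingleton, ← Real.enorm_eq_ofReal_abs]
        exact lintegral_mono_set sdiff_subset
    _ = ∫⁻ x in uIoc a b, ‖f' x‖ₑ := by
        rw [uIcc, uIoc, setLIntegral_congr Ioc_ae_eq_Icc]

open AbsolutelyContinuousOnInterval in
/-- A continuous function, differentiable off a closed set with null image and with integrable
derivative, is absolutely continuous. -/
theorem absolutelyContinuousOnInterval_of_hasDerivAt_off {f f' : ℝ → ℝ} {K : Set ℝ}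
    (hf : Continuous f) (hK : IsClosed K) (hfK : volume (f '' K) = 0)
    (hf' : ∀ x ∉ K, HasDerivAt f (f' x) x) (hint : ∫⁻ x, ‖f' x‖ₑ ≠ ⊤) (a b : ℝ) :
    AbsolutelyContinuousOnInterval f a b := by
  have h1 : Tendsto (fun E : ℕ × (ℕ → ℝ × ℝ) =>
      ∫⁻ x in ⋃ i ∈ Finset.range E.1, uIoc (E.2 i).1 (E.2 i).2, ‖f' x‖ₑ)
      (totalLengthFilter ⊓ 𝓟 (disjWithin a b)) (𝓝 0) :=
    tendsto_setLIntegral_zero hint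
      (tendsto_volume_totalLengthFilter_nhds_zero.mono_left inf_le_left)
  have h2 : Tendsto (fun E : ℕ × (ℕ → ℝ × ℝ) =>
      ENNReal.ofReal (∑ i ∈ Finset.range E.1, dist (f (E.2 i).1) (f (E.2 i).2)))
      (totalLengthFilter ⊓ 𝓟 (disjWithin a b)) (𝓝 0) := by
    refine tendsto_of_tendsto_of_tendsto_of_le_of_le' tendsto_const_nhds h1
      (Eventually.of_forall fun _ => zero_le) ?_
    filter_upwards [mem_inf_of_right (mem_principal_self _)] with E hE
    rw [ENNReal.ofReal_sum_of_nonneg fun _ _ => dist_nonneg,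
      lintegral_biUnion_finset hE.2 fun _ _ => measurableSet_uIoc]
    refine Finset.sum_le_sum fun i _ => ?_
    rw [← edist_dist]
    exact edist_image_le_lintegral_deriv hf hK hfK hf' _ _
  have h3 := (ENNReal.tendsto_toReal ENNReal.zero_ne_top).comp h2
  refine h3.congr fun E => ?_
  simp [ENNReal.toReal_ofReal (Finset.sum_nonneg fun _ _ => dist_nonneg)]

/-- Integration by parts on the line, for a function differentiable off a closed null set with null
image. -/
theorem integral_deriv_mul_add_mul_deriv_eq_zero {f f' g g' : ℝ → ℝ} {K : Set ℝ}
    (hf : Continuous f) (hfc : HasCompactSupport f) (hK : IsClosed K) (hK0 : volume K = 0)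
    (hfK : volume (f '' K) = 0) (hf' : ∀ x ∉ K, HasDerivAt f (f' x) x)
    (hint : ∫⁻ x, ‖f' x‖ₑ ≠ ⊤) (hg : ContDiff ℝ 1 g) (hg' : ∀ x, HasDerivAt g (g' x) x) :
    ∫ x, (f x * g' x + f' x * g x) = 0 := by
  have hae : ∀ᵐ x, x ∉ K := by
    rw [ae_iff]; simpa using hK0
  obtain ⟨R, hR⟩ := hfc.isCompact.isBounded.subset_ball 0
  rw [Real.ball_eq_Ioo] at hR
  simp only [zero_sub, zero_add] at hR
  have hcongr : ∫ x, (f x * g' x + f' x * g x) = ∫ x, (deriv f x * g x + f x * deriv g x) := by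
    refine integral_congr_ae ?_
    filter_upwards [hae] with x hx
    rw [(hf' x hx).deriv, (hg' x).deriv, add_comm]
  have hsub : Function.support (fun x => deriv f x * g x + f x * deriv g x) ⊆ Ioc (-R) R := by
    intro x hx
    have : x ∈ tsupport f := by
      by_contra h
      apply hx
      have h0 : deriv f x = 0 := by
        by_contra h'
        exact h (support_deriv_subset h')
      simp [h0, image_eq_zero_of_notMem_tsupport h]
    exact Ioo_subset_Ioc_self (hR this)
  have hz : ∀ x, x ∉ Ioo (-R) R → f x = 0 := fun x hx =>
    image_eq_zero_of_notMem_tsupport fun h => hx (hR h)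
  rw [hcongr, ← intervalIntegral.integral_eq_integral_of_support_subset hsub,
    (absolutelyContinuousOnInterval_of_hasDerivAt_off hf hK hfK hf' hint _
      _).integral_deriv_mul_eq_sub (hg.contDiffOn.absolutelyContinuousOnInterval), hz R (by simp), hz (-R) (by simp)]
  simp

/-- One directional integration by parts, for a Hölder function which is `C¹` off a closed set
`Λ`, by slicing along the lines parallel to `a`. -/
theorem integral_mul_fderiv_add_fderiv_mul_eq_zero
    {E : Type*} [NormedAddCommGroup E] [InnerProductSpace ℝ E] [MeasurableSpace E] [BorelSpace E]
    {a b : E} (ha : ‖a‖ = 1) (hb : ‖b‖ = 1) (hab : ⟪b, a⟫ = 0) {μ : Measure E}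
    (hP : MeasurePreserving (fun z : ℝ × ℝ => z.1 • a + z.2 • b) volume μ)
    {α : NNReal} (hα : 0 < α) {Λ : Set E} (hΛ : IsClosed Λ) (hΛμ : μ Λ = 0)
    (hΛH : μH[1 + α] Λ = 0) {u φ : E → ℝ} (hu : HasCompactSupport u) {C : NNReal}
    (hH : HolderWith C α u) (hdiff : ∀ x ∉ Λ, DifferentiableAt ℝ u x)
    (hφ : ContDiff ℝ 1 φ)
    (hint1 : Integrable (fun x => fderiv ℝ u x a) μ)
    (hint : Integrable (fun x => u x * fderiv ℝ φ x a + fderiv ℝ u x a * φ x) μ) :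
    ∫ x, (u x * fderiv ℝ φ x a + fderiv ℝ u x a * φ x) ∂μ = 0 := by
  set P : ℝ × ℝ → E := fun z => z.1 • a + z.2 • b with hPdef
  have hiso : ∀ t : ℝ, Isometry fun s : ℝ => P (s, t) := fun t =>
    Isometry.of_dist_eq fun s s' => by
      simp [hPdef, dist_eq_norm, ← sub_smul, norm_smul, ha]
  have hpP : ∀ z, ⟪b, P z⟫ = z.2 := fun z => by
    simp [hPdef, inner_add_right, inner_smul_right, hab, hb]
  have hlip : LipschitzWith 1 fun x : E => ⟪b, x⟫ := by
    refine LipschitzWith.of_dist_le_mul fun x y => ?_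
    rw [Real.dist_eq, ← inner_sub_right, dist_eq_norm]
    simpa [hb] using abs_real_inner_le_norm b (x - y)
  have hslice : ∀ᵐ t : ℝ, volume {s : ℝ | P (s, t) ∈ Λ} = 0 := by
    have h0 : volume (P ⁻¹' Λ) = 0 := by
      rw [hP.measure_preimage hΛ.nullMeasurableSet, hΛμ]
    have hswap : MeasurePreserving Prod.swap ((volume : Measure ℝ).prod volume)
        ((volume : Measure ℝ).prod volume) := Measure.measurePreserving_swap
    have := Measure.ae_ae_of_ae_prod
      (hswap.quasiMeasurePreserving.ae (measure_eq_zero_iff_ae_notMem.mp h0))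
    filter_upwards [this] with t ht
    exact measure_eq_zero_iff_ae_notMem.mpr ht
  have hcompP : Integrable (fun z => u (P z) * fderiv ℝ φ (P z) a + fderiv ℝ u (P z) a * φ (P z))
      ((volume : Measure ℝ).prod volume) := hP.integrable_comp_of_integrable hint
  have hcomp1 : Integrable (fun z => fderiv ℝ u (P z) a) ((volume : Measure ℝ).prod volume) :=
    hP.integrable_comp_of_integrable hint1
  have hmapint : ∫ x, (u x * fderiv ℝ φ x a + fderiv ℝ u x a * φ x) ∂μ =
      ∫ z, (u (P z) * fderiv ℝ φ (P z) a + fderiv ℝ u (P z) a * φ (P z))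
        ∂((volume : Measure ℝ).prod volume) := by
    rw [← hP.map_eq, integral_map hP.measurable.aemeasurable]
    · rfl
    · rw [hP.map_eq]; exact hint.aestronglyMeasurable
  rw [hmapint, integral_prod_symm _ hcompP]
  refine integral_eq_zero_of_ae ?_
  filter_upwards [hslice, hcomp1.prod_left_ae,
    ae_hausdorffMeasure_inter_preimage_eq_zero hlip (NNReal.coe_pos.mpr hα) hΛH]
    with t ht0 htint htH
  have hline : ∀ s, HasDerivAt (fun s : ℝ => P (s, t)) a s := fun s => by
    simpa [hPdef] using ((hasDerivAt_id s).smul_const a).add_const (t • b)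
  have hcont : Continuous fun s : ℝ => P (s, t) := (hiso t).continuous
  refine integral_deriv_mul_add_mul_deriv_eq_zero (K := {s : ℝ | P (s, t) ∈ Λ})
    (f := fun s => u (P (s, t))) (g := fun s => φ (P (s, t)))
    ((hH.continuous hα).comp hcont) (hu.comp_isClosedEmbedding (hiso t).isClosedEmbedding)
    (hΛ.preimage hcont) ht0 ?_ ?_ htint.2.ne ?_ ?_
  · have hsub : (fun s => u (P (s, t))) '' {s : ℝ | P (s, t) ∈ Λ} ⊆
        u '' (Λ ∩ (fun x : E => ⟪b, x⟫) ⁻¹' {t}) := by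
      rintro _ ⟨s, hs, rfl⟩
      exact ⟨P (s, t), ⟨hs, hpP _⟩, rfl⟩
    refine measure_mono_null hsub ?_
    rw [← hausdorffMeasure_real]
    refine le_antisymm (((hH.holderOnWith _).hausdorffMeasure_image_le hα zero_le_one).trans ?_)
      zero_le
    rw [mul_one, htH, mul_zero]
  · intro s hs
    exact (hdiff _ hs).hasFDerivAt.comp_hasDerivAt s (hline s)
  · refine hφ.comp ?_
    fun_prop
  · intro s
    exact (hφ.differentiable one_ne_zero _).hasFDerivAt.comp_hasDerivAt s (hline s)

theorem measurePreserving_smul_single_add_smul_single (i j : Fin 2) (hij : i ≠ j) :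
    MeasurePreserving (fun z : ℝ × ℝ => z.1 • EuclideanSpace.single i (1 : ℝ) +
      z.2 • EuclideanSpace.single j (1 : ℝ)) volume volume := by
  have h0 : MeasurePreserving (fun z : ℝ × ℝ => WithLp.toLp 2 ![z.1, z.2]) volume volume :=
    (PiLp.volume_preserving_toLp (Fin 2)).comp (volume_preserving_finTwoArrow ℝ).symm
  have h1 : MeasurePreserving (fun z : ℝ × ℝ => WithLp.toLp 2 ![z.2, z.1]) volume volume :=
    h0.comp (Measure.measurePreserving_swap (μ := (volume : Measure ℝ))
      (ν := (volume : Measure ℝ)))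
  obtain ⟨rfl, rfl⟩ | ⟨rfl, rfl⟩ : (i = 0 ∧ j = 1) ∨ (i = 1 ∧ j = 0) := by lia
  · convert! h0 using 2 with z
    ext k
    fin_cases k <;> simp
  · convert! h1 using 2 with z
    ext k
    fin_cases k <;> simp

theorem integrable_fderiv_apply_mul {E : Type*} [NormedAddCommGroup E] [NormedSpace ℝ E]
    [MeasurableSpace E] [BorelSpace E] {μ : Measure E} {u φ : E → ℝ} (hu : HasCompactSupport u)
    (hφ : Continuous φ) {a : E} (h : Integrable (fun x => fderiv ℝ u x a) μ) :
    Integrable (fun x => fderiv ℝ u x a * φ x) μ := by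
  have hK : IsCompact (tsupport u) := hu
  refine (integrableOn_iff_integrable_of_support_subset ?_).mp
    (h.integrableOn.mul_continuousOn hφ.continuousOn hK)
  intro x hx
  by_contra hx'
  apply hx
  simp [fderiv_of_notMem_tsupport ℝ hx']

theorem volume_unitSquare_lt_top : volume unitSquare < ⊤ := by
  refine Bornology.IsBounded.measure_lt_top (isBounded_iff_forall_norm_le.mpr ⟨2, fun x hx => ?_⟩)
  rw [EuclideanSpace.norm_eq, Fin.sum_univ_two, Real.sqrt_le_left (by norm_num)]
  have h0 := hx 0
  have h1 := hx 1
  simp only [Real.norm_eq_abs, sq_abs]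
  nlinarith [h0.1, h0.2, h1.1, h1.2]

end Slicing

/-- Lemma 6.4 (lm:H1), reduced to the unit square: a compactly supported `α`-Hölder
function, smooth off a compact set `Λ` of Hausdorff dimension `< 1 + α` and with
square-integrable gradient off `Λ`, lies in `H¹`: for every `C¹` vector field `v`,
`∫ u · div v = -∫ ⟨∇u, v⟩`. -/
theorem stmt_0 (α : ℝ) (hα : α ∈ Set.Ioo (0:ℝ) 1)
    (Λ : Set (EuclideanSpace ℝ (Fin 2))) (hΛc : IsCompact Λ) (hΛs : Λ ⊆ unitSquare)
    (hdim : dimH Λ < ENNReal.ofReal (1 + α))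
    (u : EuclideanSpace ℝ (Fin 2) → ℝ)
    (hsupp : HasCompactSupport u) (hsupps : tsupport u ⊆ unitSquare)
    (hHol : ∃ C > (0:ℝ), ∀ x y, |u x - u y| ≤ C * ‖x - y‖ ^ α)
    (hdiff : ∀ x ∉ Λ, ContDiffAt ℝ 1 u x)
    (hint : ∫⁻ x in unitSquare \ Λ, (‖gradient u x‖₊ : ℝ≥0∞) ^ 2 < ⊤) :
    ∀ v : EuclideanSpace ℝ (Fin 2) → EuclideanSpace ℝ (Fin 2), ContDiff ℝ 1 v →
      ∫ x in unitSquare, u x * LinearMap.trace ℝ _ ((fderiv ℝ v x).toLinearMap)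
        = - ∫ x in unitSquare \ Λ, ⟪gradient u x, v x⟫ := by
  intro v hv
  obtain ⟨C, hC, hHol⟩ := hHol
  lift C to NNReal using hC.le
  lift α to NNReal using hα.1.le
  have hHW : HolderWith C α u := fun x y => by
    rw [edist_dist, edist_dist, ENNReal.ofReal_rpow_of_nonneg dist_nonneg hα.1.le,
      ← ENNReal.ofReal_coe_nnreal, ← ENNReal.ofReal_mul hC.le, Real.dist_eq, dist_eq_norm]
    exact ENNReal.ofReal_le_ofReal (hHol x y)
  have hcont : Continuous u := hHW.continuous hα.1
  have hΛH : μH[1 + α] Λ = 0 := by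
    have := hausdorffMeasure_of_dimH_lt (s := Λ) (d := 1 + α) (by
      convert hdim
      rw [← ENNReal.ofReal_coe_nnreal]
      simp)
    simpa using this
  have hΛ2 : μH[Module.finrank ℝ (EuclideanSpace ℝ (Fin 2))] Λ = 0 := by
    refine le_antisymm ((Measure.hausdorffMeasure_mono ?_ Λ).trans hΛH.le) zero_le
    simp only [finrank_euclideanSpace_fin, Nat.cast_ofNat]
    linarith [hα.2]
  have hΛ0 : volume Λ = 0 :=
    Measure.absolutelyContinuous_isAddHaarMeasure volume
      μH[Module.finrank ℝ (EuclideanSpace ℝ (Fin 2))] hΛ2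
  have hout : ∀ x ∉ unitSquare, u x = 0 ∧ fderiv ℝ u x = 0 := fun x hx =>
    ⟨image_eq_zero_of_notMem_tsupport fun h => hx (hsupps h),
      fderiv_of_notMem_tsupport ℝ fun h => hx (hsupps h)⟩
  have haeq : (unitSquare \ Λ : Set _) =ᵐ[volume] unitSquare := sdiff_null_ae_eq_self hΛ0
  have hd1 : ∀ a : EuclideanSpace ℝ (Fin 2), ‖a‖ = 1 →
      Integrable (fun x => fderiv ℝ u x a) volume := by
    intro a ha
    refine (integrableOn_iff_integrable_of_support_subset (s := unitSquare) ?_).mp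
      ⟨(measurable_fderiv_apply_const ℝ u a).aestronglyMeasurable, ?_⟩
    · intro x hx
      by_contra hx'
      exact hx (by simp [(hout x hx').2])
    · calc ∫⁻ x in unitSquare, ‖fderiv ℝ u x a‖ₑ
          = ∫⁻ x in unitSquare \ Λ, ‖fderiv ℝ u x a‖ₑ := (setLIntegral_congr haeq).symm
        _ ≤ ∫⁻ x in unitSquare \ Λ, (1 + (‖gradient u x‖₊ : ℝ≥0∞) ^ 2) := by
          refine lintegral_mono fun x => ?_
          have h1 : ‖fderiv ℝ u x a‖₊ ≤ ‖gradient u x‖₊ := by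
            rw [← inner_gradient_left]
            simpa [show ‖a‖₊ = 1 from NNReal.eq ha] using
              nnnorm_inner_le_nnnorm (𝕜 := ℝ) (gradient u x) a
          have h2 : ‖gradient u x‖₊ ≤ 1 + ‖gradient u x‖₊ ^ 2 := by
            rw [← NNReal.coe_le_coe]
            push_cast
            nlinarith [sq_nonneg (‖gradient u x‖ - 1)]
          rw [enorm_eq_nnnorm]
          exact (ENNReal.coe_le_coe.mpr (h1.trans h2)).trans_eq (by push_cast; rfl)
        _ < ⊤ := by
          rw [lintegral_add_left measurable_const, setLIntegral_one]
          exact ENNReal.add_lt_top.mpr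
            ⟨(measure_mono Set.sdiff_subset).trans_lt volume_unitSquare_lt_top, hint⟩
  have hne : ∀ i : Fin 2, i ≠ 1 - i := by decide
  set e : Fin 2 → EuclideanSpace ℝ (Fin 2) := fun i => EuclideanSpace.single i (1 : ℝ) with he
  have hvi : ∀ i : Fin 2, ContDiff ℝ 1 fun x => v x i := contDiff_euclidean.mp hv
  have hfd : ∀ i x, fderiv ℝ (fun x => v x i) x (e i) = (fderiv ℝ v x (e i)) i := by
    intro i x
    have := ((EuclideanSpace.proj (𝕜 := ℝ) i).hasFDerivAt.comp x
      (hv.differentiable one_ne_zero x).hasFDerivAt).fderiv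
    exact congrArg (fun L => L (e i)) this
  have hI2 : ∀ i, Integrable (fun x => fderiv ℝ u x (e i) * v x i) volume := fun i =>
    integrable_fderiv_apply_mul hsupp (hvi i).continuous (hd1 _ (by simp [he]))
  have hI1 : ∀ i, Integrable (fun x => u x * fderiv ℝ (fun x => v x i) x (e i)) volume := fun i =>
    (hcont.mul (((hvi i).continuous_fderiv one_ne_zero).clm_apply
      continuous_const)).integrable_of_hasCompactSupport hsupp.mul_right
  have hpart : ∀ i, ∫ x, u x * fderiv ℝ (fun x => v x i) x (e i) =
      - ∫ x, fderiv ℝ u x (e i) * v x i := by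
    intro i
    rw [eq_neg_iff_add_eq_zero, ← integral_add (hI1 i) (hI2 i)]
    exact integral_mul_fderiv_add_fderiv_mul_eq_zero (a := e i) (b := e (1 - i)) (by simp [he])
      (by simp [he]) (by simp [he, EuclideanSpace.inner_single_left, hne i])
      (measurePreserving_smul_single_add_smul_single i (1 - i) (hne i)) (α := α) hα.1
      hΛc.isClosed hΛ0 hΛH hsupp hHW (fun x hx => (hdiff x hx).differentiableAt one_ne_zero)
      (hvi i) (hd1 _ (by simp [he])) ((hI1 i).add (hI2 i))
  have hL : ∫ x in unitSquare, u x * LinearMap.trace ℝ _ ((fderiv ℝ v x).toLinearMap) =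
      ∑ i, ∫ x, u x * fderiv ℝ (fun x => v x i) x (e i) := by
    rw [setIntegral_eq_integral_of_forall_compl_eq_zero fun x hx => by simp [(hout x hx).1],
      ← integral_finsetSum _ fun i _ => hI1 i]
    refine integral_congr_ae (Filter.Eventually.of_forall fun x => ?_)
    simp only [LinearMap.trace_eq_sum_inner _ (EuclideanSpace.basisFun (Fin 2) ℝ), hfd,
      Finset.mul_sum]
    simp [he, EuclideanSpace.inner_single_left]
  have hR : ∫ x in unitSquare \ Λ, ⟪gradient u x, v x⟫ =
      ∑ i, ∫ x, fderiv ℝ u x (e i) * v x i := by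
    rw [setIntegral_congr_set haeq]
    simp only [inner_gradient_left]
    rw [setIntegral_eq_integral_of_forall_compl_eq_zero fun x hx => by simp [(hout x hx).2],
      ← integral_finsetSum _ fun i _ => hI2 i]
    refine integral_congr_ae (Filter.Eventually.of_forall fun x => ?_)
    have hx : v x = ∑ i, v x i • e i := by
      ext k
      fin_cases k <;> simp [he]
    calc fderiv ℝ u x (v x) = fderiv ℝ u x (∑ i, v x i • e i) := by rw [← hx]
      _ = ∑ i, fderiv ℝ u x (e i) * v x i := by simp [mul_comm]
  rw [hL, hR, Finset.sum_congr rfl fun i _ => hpart i, Finset.sum_neg_distrib]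
end

section
/- Let E be a real inner product space, let x, y ∈ E with ‖x‖ ≤ 1 and ‖y‖ ≤ 1, and let z be a point of the segment [x,y] such that ‖z‖ ≤ ‖w‖ for every w in the segment [x,y]. Then ⟨z, x − z⟩ ≥ 0 and ⟨z, y − z⟩ ≥ 0; consequently ‖x − z‖² ≤ 1 − ‖z‖², ‖y − z‖² ≤ 1 − ‖z‖², and ‖x − y‖ ≤ 2·√2·√(1 − ‖z‖). -/
open scoped RealInnerProductSpace

/-- A point of minimal norm in a convex set makes an angle of at least `π/2` with the
directions towards the other points of the set. -/
theorem Convex.real_inner_sub_nonneg_of_forall_norm_le {E : Type*} [NormedAddCommGroup E]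
    [InnerProductSpace ℝ E] {K : Set E} (hK : Convex ℝ K) {z : E} (hz : z ∈ K)
    (hmin : ∀ w ∈ K, ‖z‖ ≤ ‖w‖) {w : E} (hw : w ∈ K) : 0 ≤ inner ℝ z (w - z) := by
  have : Nonempty K := ⟨⟨z, hz⟩⟩
  have hInf : ‖(0 : E) - z‖ = ⨅ w : K, ‖(0 : E) - w‖ := by
    simp only [zero_sub, norm_neg]
    exact le_antisymm (le_ciInf fun w => hmin w w.2)
      (ciInf_le ⟨0, by rintro _ ⟨w, rfl⟩; exact norm_nonneg _⟩ (⟨z, hz⟩ : K))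
  simpa using (norm_eq_iInf_iff_real_inner_le_zero hK hz).1 hInf w hw

theorem norm_sub_sq_le_of_real_inner_sub_nonneg {E : Type*} [NormedAddCommGroup E]
    [InnerProductSpace ℝ E] {z w : E} (h : 0 ≤ inner ℝ z (w - z)) :
    ‖w - z‖ ^ 2 ≤ ‖w‖ ^ 2 - ‖z‖ ^ 2 := by
  have := norm_add_sq_real z (w - z)
  rw [add_sub_cancel] at this
  linarith

/-- Proposition 5.2 (pr:zb): if `z` is a point of minimal norm on the segment `[x,y]`
with `x, y` in the closed unit ball, then the angles at `z` of the triangles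
`(0,z,x)` and `(0,z,y)` are at least `π/2`, and the stated norm bounds follow. -/
theorem stmt_1 {E : Type*} [NormedAddCommGroup E] [InnerProductSpace ℝ E]
    (x y z : E) (hx : ‖x‖ ≤ 1) (hy : ‖y‖ ≤ 1)
    (hz : z ∈ segment ℝ x y) (hmin : ∀ w ∈ segment ℝ x y, ‖z‖ ≤ ‖w‖) :
    0 ≤ ⟪z, x - z⟫ ∧ 0 ≤ ⟪z, y - z⟫ ∧
    ‖x - z‖ ^ 2 ≤ 1 - ‖z‖ ^ 2 ∧ ‖y - z‖ ^ 2 ≤ 1 - ‖z‖ ^ 2 ∧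
    ‖x - y‖ ≤ 2 * Real.sqrt 2 * Real.sqrt (1 - ‖z‖) := by
  have hK := convex_segment (𝕜 := ℝ) x y
  have hzx := hK.real_inner_sub_nonneg_of_forall_norm_le hz hmin (left_mem_segment ℝ x y)
  have hzy := hK.real_inner_sub_nonneg_of_forall_norm_le hz hmin (right_mem_segment ℝ x y)
  have hx2 : ‖x - z‖ ^ 2 ≤ 1 - ‖z‖ ^ 2 :=
    (norm_sub_sq_le_of_real_inner_sub_nonneg hzx).trans
      (sub_le_sub_right (pow_le_one₀ (norm_nonneg x) hx) _)
  have hy2 : ‖y - z‖ ^ 2 ≤ 1 - ‖z‖ ^ 2 :=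
    (norm_sub_sq_le_of_real_inner_sub_nonneg hzy).trans
      (sub_le_sub_right (pow_le_one₀ (norm_nonneg y) hy) _)
  refine ⟨hzx, hzy, hx2, hy2, ?_⟩
  have hbound : 1 - ‖z‖ ^ 2 ≤ 2 * (1 - ‖z‖) := by linarith [sq_nonneg (1 - ‖z‖)]
  calc ‖x - y‖ ≤ ‖x - z‖ + ‖y - z‖ := by
        simpa only [norm_sub_rev z y] using norm_sub_le_norm_sub_add_norm_sub x z y
    _ ≤ √(2 * (1 - ‖z‖)) + √(2 * (1 - ‖z‖)) :=
        add_le_add (Real.le_sqrt_of_sq_le (hx2.trans hbound))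
          (Real.le_sqrt_of_sq_le (hy2.trans hbound))
    _ = 2 * Real.sqrt 2 * Real.sqrt (1 - ‖z‖) := by
        rw [Real.sqrt_mul zero_le_two]
        ring
end

section
/- For every C₀ > 0 there exist C₁ > 0 and ε ∈ (0,1) such that for all real numbers r₀, r, δ₀ with 0 ≤ r₀ ≤ r < 1, 0 < δ₀ < ε, and r ≤ r₀ + C₀·δ₀·√(1 − r₀) + δ₀², the following two inequalities hold: √(1 − r₀) − √(1 − r) ≤ C₁·δ₀, and √(1 − r)·|log((1 − r)/(1 − r₀))| ≤ C₁·δ₀·|log δ₀|. -/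
/-- If `a ^ 2 - b ^ 2 ≤ C * δ * a + δ ^ 2` with `0 ≤ b`, then `a - b` is at most linear in `δ`. -/
theorem sub_le_of_sq_sub_sq_le {a b C δ : ℝ} (hb : 0 ≤ b) (hC : 0 ≤ C) (hδ : 0 < δ)
    (h : a ^ 2 - b ^ 2 ≤ C * δ * a + δ ^ 2) : a - b ≤ (C + 1) * δ := by
  by_contra! hlt
  have hδa : δ < a := by nlinarith [mul_nonneg hC hδ.le]
  have h1 : (C + 1) * δ * a < (a - b) * a := mul_lt_mul_of_pos_right hlt (hδ.trans hδa)
  have h2 : 0 ≤ (a - b) * b :=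
    mul_nonneg ((mul_pos (by linarith) hδ).trans hlt).le hb
  have h3 : δ * δ < δ * a := mul_lt_mul_of_pos_left hδa hδ
  nlinarith

/-- The elementary bound `b * |log (b ^ 2 / a ^ 2)| ≤ 2 * (a - b)` for `0 < b ≤ a`. -/
theorem mul_abs_log_sq_div_sq_le {a b : ℝ} (hb : 0 < b) (hba : b ≤ a) :
    b * |Real.log (b ^ 2 / a ^ 2)| ≤ 2 * (a - b) := by
  have ha : 0 < a := hb.trans_le hba
  have hlog : Real.log (b / a) ≤ 0 := Real.log_nonpos (by positivity) ((div_le_one ha).2 hba)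
  have h : 1 - (b / a)⁻¹ ≤ Real.log (b / a) := Real.one_sub_inv_le_log_of_pos (by positivity)
  have hmul : b * (1 - (b / a)⁻¹) = b - a := by field_simp
  have h' := mul_le_mul_of_nonneg_left h hb.le
  rw [← div_pow, Real.log_pow, abs_mul, abs_of_nonpos hlog, Nat.cast_ofNat, abs_two]
  linarith

/-- Proposition 5.4 (pr:bornes-tech): technical estimates relating `r₀`, `r` and `δ₀`. -/
theorem stmt_2 (C₀ : ℝ) (hC₀ : 0 < C₀) :
    ∃ C₁ > (0:ℝ), ∃ ε ∈ Set.Ioo (0:ℝ) 1,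
      ∀ r₀ r δ₀ : ℝ, 0 ≤ r₀ → r₀ ≤ r → r < 1 → 0 < δ₀ → δ₀ < ε →
        r ≤ r₀ + C₀ * δ₀ * Real.sqrt (1 - r₀) + δ₀ ^ 2 →
        Real.sqrt (1 - r₀) - Real.sqrt (1 - r) ≤ C₁ * δ₀ ∧
        Real.sqrt (1 - r) * |Real.log ((1 - r) / (1 - r₀))| ≤ C₁ * δ₀ * |Real.log δ₀| := by
  refine ⟨2 * (C₀ + 1), by positivity, Real.exp (-1),
    ⟨Real.exp_pos _, Real.exp_lt_one_iff.2 (by norm_num)⟩, ?_⟩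
  intro r₀ r δ hr₀ hr₀r hr hδ hδε h
  have hb : 0 < √(1 - r) := Real.sqrt_pos.2 (by linarith)
  have hba : √(1 - r) ≤ √(1 - r₀) := Real.sqrt_le_sqrt (by linarith)
  have hb2 : √(1 - r) ^ 2 = 1 - r := Real.sq_sqrt (by linarith)
  have ha2 : √(1 - r₀) ^ 2 = 1 - r₀ := Real.sq_sqrt (by linarith)
  have hsub : √(1 - r₀) - √(1 - r) ≤ (C₀ + 1) * δ :=
    sub_le_of_sq_sub_sq_le hb.le hC₀.le hδ (by linarith)
  have hpos : 0 < (C₀ + 1) * δ := by positivity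
  refine ⟨by linarith, ?_⟩
  have hlogδ : 1 ≤ |Real.log δ| := by
    have := (Real.log_lt_iff_lt_exp hδ).2 hδε
    exact le_abs.2 (Or.inr (by linarith))
  have hlog := mul_abs_log_sq_div_sq_le hb hba
  rw [hb2, ha2] at hlog
  calc √(1 - r) * |Real.log ((1 - r) / (1 - r₀))| ≤ 2 * (C₀ + 1) * δ := by linarith
    _ ≤ 2 * (C₀ + 1) * δ * |Real.log δ| := le_mul_of_one_le_right (by positivity) hlogδ
end

section
/- Let Λ be a nonempty compact subset of ℝ², and suppose there exist c > 0 and d ∈ (0,2) such that for every ε ∈ (0,1) the set Λ can be covered by at most c·ε^{−d} closed balls of radius ε. Then for every bounded measurable set K ⊂ ℝ², the function x ↦ log(dist(x, Λ)) is square-integrable on K with respect to Lebesgue measure, i.e. ∫_K (log(dist(x,Λ)))² dx < ∞. -/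
open MeasureTheory

/-- If the sublevel sets `{f < 2⁻⁽ⁿ⁺¹⁾}` of a bounded nonnegative function decay geometrically in
measure, then `log ∘ f` is square-integrable. -/
theorem integrable_log_sq_of_measure_lt_le {X : Type*} [MeasurableSpace X] {μ : Measure X}
    [IsFiniteMeasure μ] {f : X → ℝ} (hf : Measurable f) (hf0 : ∀ x, 0 ≤ f x) {B : ℝ}
    (hB : ∀ᵐ x ∂μ, f x ≤ B) {C r : ℝ} (hr0 : 0 ≤ r) (hr1 : r < 1)
    (hμ : ∀ n : ℕ, μ {x | f x < (1 / 2 : ℝ) ^ (n + 1)} ≤ ENNReal.ofReal (C * r ^ n)) :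
    Integrable (fun x => Real.log (f x) ^ 2) μ := by
  have hlog2 : Real.log 2 ≤ 1 := by linarith [Real.log_two_lt_d9]
  have hmeas (n : ℕ) : MeasurableSet {x | f x < (1 / 2 : ℝ) ^ (n + 1)} :=
    measurableSet_lt hf measurable_const
  have hpt : ∀ᵐ x ∂μ, ENNReal.ofReal (Real.log (f x) ^ 2) ≤ ENNReal.ofReal (4 + B ^ 2) +
      ∑' n : ℕ, {x | f x < (1 / 2 : ℝ) ^ (n + 1)}.indicator
        (fun _ => ENNReal.ofReal (((n : ℝ) + 3) ^ 2)) x := by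
    filter_upwards [hB] with x hx
    rcases le_or_gt (1 / 4) (f x) with h | h
    · refine le_add_right (ENNReal.ofReal_le_ofReal ?_)
      have hup : Real.log (f x) ≤ f x - 1 := Real.log_le_sub_one_of_pos (by linarith)
      have hlow : -2 ≤ Real.log (f x) := by
        have := Real.log_le_log (by norm_num) h
        rw [show (1 / 4 : ℝ) = (2 ^ 2)⁻¹ by norm_num, Real.log_inv, Real.log_pow] at this
        push_cast at this
        linarith
      rcases le_total 0 (Real.log (f x)) with h0 | h0 <;> nlinarith
    · rcases (hf0 x).eq_or_lt with h0 | h0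
      · simp [← h0]
      · obtain ⟨n, hn1, hn2⟩ := exists_nat_pow_near_of_lt_one (x := 4 * f x) (y := (1 / 2 : ℝ))
          (by linarith) (by linarith) (by norm_num) (by norm_num)
        have hn1' : (1 / 2 : ℝ) ^ (n + 3) < f x := by
          rw [pow_add _ (n + 1) 2]; linarith
        have hlow : -((n : ℝ) + 3) ≤ Real.log (f x) := by
          have := Real.log_le_log (by positivity) hn1'.le
          rw [Real.log_pow, one_div, Real.log_inv] at this
          push_cast at this
          nlinarith [(Nat.cast_nonneg n : (0 : ℝ) ≤ n)]
        have hup : Real.log (f x) ≤ 0 := Real.log_nonpos h0.le (by linarith)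
        refine le_add_left (le_trans ?_ (ENNReal.le_tsum n))
        have hmem : x ∈ {x | f x < (1 / 2 : ℝ) ^ (n + 1)} := by
          rw [Set.mem_ofPred_eq, pow_succ]
          linarith [pow_pos (by norm_num : (0 : ℝ) < 1 / 2) n]
        rw [Set.indicator_of_mem hmem]
        exact ENNReal.ofReal_le_ofReal (by nlinarith)
  refine ⟨(hf.log.pow_const 2).aestronglyMeasurable, ?_⟩
  rw [hasFiniteIntegral_iff_ofReal (Filter.Eventually.of_forall fun x => sq_nonneg _)]
  refine (lintegral_mono_ae hpt).trans_lt ?_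
  rw [lintegral_add_left measurable_const, lintegral_const,
    lintegral_tsum fun n => (measurable_const.indicator (hmeas n)).aemeasurable]
  refine ENNReal.add_lt_top.2 ⟨ENNReal.mul_lt_top ENNReal.ofReal_lt_top (measure_lt_top _ _), ?_⟩
  have hsum : Summable fun n : ℕ => ((n : ℝ) + 3) ^ 2 * (C * r ^ n) := by
    have hr : ‖r‖ < 1 := by rwa [Real.norm_of_nonneg hr0]
    have h (k : ℕ) := summable_pow_mul_geometric_of_norm_lt_one k hr
    refine (((h 2).add ((h 1).mul_left 6)).add ((h 0).mul_left 9)).mul_left C |>.congr fun n => ?_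
    ring
  refine (ENNReal.tsum_le_tsum fun n => ?_).trans_lt hsum.tsum_ofReal_lt_top
  rw [lintegral_indicator_const (hmeas n), ENNReal.ofReal_mul (by positivity)]
  gcongr
  exact hμ n

/-- A set covered by `N` closed balls of radius `ε` has an `ε`-neighbourhood covered by the `N`
concentric balls of radius `2 * ε`. -/
theorem volume_infDist_lt_le {Λ : Set (EuclideanSpace ℝ (Fin 2))} (hne : Λ.Nonempty) {ε : ℝ}
    (hε : 0 ≤ ε) {s : Finset (EuclideanSpace ℝ (Fin 2))}
    (hs : Λ ⊆ ⋃ p ∈ s, Metric.closedBall p ε) :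
    volume {x | Metric.infDist x Λ < ε} ≤ ENNReal.ofReal
      (s.card * ((2 * ε) ^ 2 * volume.real (Metric.ball (0 : EuclideanSpace ℝ (Fin 2)) 1))) := by
  have hsub : {x | Metric.infDist x Λ < ε} ⊆ ⋃ p ∈ s, Metric.closedBall p (2 * ε) := by
    intro x hx
    obtain ⟨y, hy, hxy⟩ := (Metric.infDist_lt_iff hne).1 hx
    obtain ⟨p, hp, hyp⟩ := Set.mem_iUnion₂.1 (hs hy)
    refine Set.mem_iUnion₂.2 ⟨p, hp, ?_⟩
    rw [Metric.mem_closedBall] at hyp ⊢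
    linarith [dist_triangle x y p]
  refine (measure_mono hsub).trans ((measure_biUnion_finset_le _ _).trans_eq ?_)
  simp_rw [Measure.addHaar_closedBall volume _ (by positivity : 0 ≤ 2 * ε)]
  rw [Finset.sum_const, nsmul_eq_mul, finrank_euclideanSpace_fin, ENNReal.ofReal_mul (by positivity),
    ENNReal.ofReal_mul (by positivity), ofReal_measureReal measure_ball_lt_top.ne,
    ENNReal.ofReal_natCast]

/-- Proposition 6.3 (pr:log): if a nonempty compact set `Λ ⊆ ℝ²` has upper Minkowski
(box-counting) dimension at most `d < 2`, expressed via covering numbers, then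
`log (dist (·, Λ))` is square-integrable on every bounded measurable set. -/
theorem stmt_3 (Λ : Set (EuclideanSpace ℝ (Fin 2)))
    (hne : Λ.Nonempty) (hcomp : IsCompact Λ)
    (c d : ℝ) (hc : 0 < c) (hd : d ∈ Set.Ioo (0:ℝ) 2)
    (hcov : ∀ ε ∈ Set.Ioo (0:ℝ) 1,
      ∃ s : Finset (EuclideanSpace ℝ (Fin 2)),
        (s.card : ℝ) ≤ c * ε ^ (-d) ∧ Λ ⊆ ⋃ p ∈ s, Metric.closedBall p ε) :
    ∀ K : Set (EuclideanSpace ℝ (Fin 2)), Bornology.IsBounded K → MeasurableSet K →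
      IntegrableOn (fun x => (Real.log (Metric.infDist x Λ)) ^ 2) K volume := by
  intro K hK hKm
  have : IsFiniteMeasure (volume.restrict K) := ⟨by simpa using hK.measure_lt_top⟩
  obtain ⟨y, hy⟩ := hne
  obtain ⟨B, hB⟩ := (Metric.isBounded_iff_subset_closedBall y).1 hK
  set v := volume.real (Metric.ball (0 : EuclideanSpace ℝ (Fin 2)) 1)
  set r : ℝ := (1 / 2) ^ (2 - d)
  have hd2 : 0 < 2 - d := sub_pos.2 hd.2
  refine integrable_log_sq_of_measure_lt_le (B := B) (C := 4 * c * v * r) (r := r)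
    (Metric.continuous_infDist_pt Λ).measurable (fun x => Metric.infDist_nonneg) ?_
    (by positivity) (Real.rpow_lt_one (by norm_num) (by norm_num) hd2) fun n => ?_
  · filter_upwards [ae_restrict_mem hKm] with x hx
    exact (Metric.infDist_le_dist_of_mem hy).trans (hB hx)
  · set ε : ℝ := (1 / 2) ^ (n + 1) with hεn
    have hε : 0 < ε := by positivity
    obtain ⟨s, hcard, hs⟩ := hcov ε ⟨hε, pow_lt_one₀ (by norm_num) (by norm_num) n.succ_ne_zero⟩
    refine (Measure.restrict_apply_le _ _).trans
      ((volume_infDist_lt_le ⟨y, hy⟩ hε.le hs).trans (ENNReal.ofReal_le_ofReal ?_))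
    have hpow : ε ^ (-d) * ε ^ 2 = r * r ^ n := by
      rw [← Real.rpow_natCast ε 2, ← Real.rpow_add hε, ← pow_succ', hεn, ← Real.rpow_natCast,
        ← Real.rpow_mul (by norm_num), ← Real.rpow_mul_natCast (by norm_num)]
      congr 1
      push_cast
      ring
    calc (s.card : ℝ) * ((2 * ε) ^ 2 * v) ≤ c * ε ^ (-d) * ((2 * ε) ^ 2 * v) := by gcongr
      _ = 4 * c * v * (ε ^ (-d) * ε ^ 2) := by ring
      _ = 4 * c * v * r * r ^ n := by rw [hpow]; ring
end

section
/- Let B be a symmetric positive definite real 2×2 matrix and let M be a symmetric real 2×2 matrix with trace(B⁻¹·M) = 0. Then det(M) ≤ 0; moreover det(M) = 0 if and only if M = 0. -/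
/-- For a symmetric positive definite `2 × 2` matrix `B` and a symmetric `M` with
`tr (B⁻¹ M) = 0`, the determinant of `M` is, up to a positive factor, minus a sum of squares. -/
theorem Matrix.sq_mul_det_eq_of_trace_inv_mul_eq_zero {B M : Matrix (Fin 2) (Fin 2) ℝ}
    (hB : B.PosDef) (hM : M.IsSymm) (htr : (B⁻¹ * M).trace = 0) :
    B 1 1 * M 0 0 - 2 * B 0 1 * M 0 1 + B 0 0 * M 1 1 = 0 ∧
      B 0 0 ^ 2 * M.det = -((B 0 0 * M 0 1 - B 0 1 * M 0 0) ^ 2 + B.det * M 0 0 ^ 2) := by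
  have hB10 : B 1 0 = B 0 1 := by simpa using hB.isHermitian.apply 0 1
  have hM10 : M 1 0 = M 0 1 := hM.apply 0 1
  have hlin : B 1 1 * M 0 0 - 2 * B 0 1 * M 0 1 + B 0 0 * M 1 1 = 0 := by
    rw [Matrix.inv_def, Ring.inverse_eq_inv', Matrix.smul_mul, Matrix.trace_smul, smul_eq_mul,
      mul_eq_zero, or_iff_right (inv_ne_zero hB.det_pos.ne')] at htr
    simp only [Matrix.adjugate_fin_two, Matrix.trace_fin_two, Matrix.mul_apply, Fin.sum_univ_two,
      Matrix.of_apply, Matrix.cons_val_zero, Matrix.cons_val_one, hB10, hM10] at htr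
    linear_combination htr
  refine ⟨hlin, ?_⟩
  rw [Matrix.det_fin_two, Matrix.det_fin_two, hB10, hM10]
  linear_combination B 0 0 * M 0 0 * hlin

/-- Algebraic step of Lemma 3.12 (lm:rig-smooth): if `B` is symmetric positive definite
and `M` is symmetric with `tr(B⁻¹ M) = 0`, then `det M ≤ 0`, with `det M = 0` iff `M = 0`. -/
theorem stmt_13 (B M : Matrix (Fin 2) (Fin 2) ℝ)
    (hB : B.PosDef) (hM : M.IsSymm) (htr : (B⁻¹ * M).trace = 0) :
    M.det ≤ 0 ∧ (M.det = 0 ↔ M = 0) := by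
  obtain ⟨hlin, hdet⟩ := Matrix.sq_mul_det_eq_of_trace_inv_mul_eq_zero hB hM htr
  have ha : 0 < B 0 0 := hB.diag_pos
  have hD : 0 < B.det := hB.det_pos
  refine ⟨?_, fun h => ?_, fun h => by simp [h]⟩
  · refine nonpos_of_mul_nonpos_right (a := B 0 0 ^ 2) ?_ (by positivity)
    rw [hdet]
    exact neg_nonpos.mpr (by positivity)
  · have hsq : (B 0 0 * M 0 1 - B 0 1 * M 0 0) ^ 2 + B.det * M 0 0 ^ 2 = 0 := by
      rw [h] at hdet
      linarith
    obtain ⟨h₁, h₂⟩ := (add_eq_zero_iff_of_nonneg (by positivity) (by positivity)).mp hsq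
    have h00 : M 0 0 = 0 := by simpa [hD.ne'] using h₂
    have h01 : M 0 1 = 0 := by simpa [h00, ha.ne'] using h₁
    have h11 : M 1 1 = 0 := by simpa [h00, h01, ha.ne'] using hlin
    have h10 : M 1 0 = 0 := (hM.apply 0 1).trans h01
    ext i j
    fin_cases i <;> fin_cases j <;> simp [h00, h01, h10, h11]
end
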